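/- arXiv:1512.02251 — 6 statements merged into one kernel-verified Lean document; each statement's English description precedes it below -/
import Mathlib

section
/- Let N ≥ 1 be a natural number, a, z ∈ ℂ with a ≠ 0, z ≠ 0 and sin(π/N) ≠ 0, set λ = (1 − z·exp(−iπ/N))(1 − z·exp(iπ/N)) with λ ≠ 0, and define X₊ = a/(N(1 − z·exp(−iπ/N))), X₋ = a/(N(1 − z·exp(iπ/N))), h = (1/2)(X₊ + X₋)/(X₊ − X₋). Let E₊, E₋ ∈ ℂ be arbitrary perturbations with (X₊ + E₊) − (X₋ + E₋) ≠ 0. Then (1/2)·((X₊+E₊)+(X₋+E₋))/((X₊+E₊)−(X₋+E₋)) = ( h + i·Nλ·(E₊+E₋)/(4 a z·sin(π/N)) ) / ( 1 + i·Nλ·(E₊−E₋)/(2 a z·sin(π/N)) ). -/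
/-- The difference of the two noiseless coefficients, expressed through the sine of the half bin
spacing. -/
theorem div_one_sub_mul_exp_sub_div_one_sub_mul_exp (n a z : ℂ) (θ : ℝ)
    (hp : 1 - z * Complex.exp (-(Complex.I * θ)) ≠ 0)
    (hm : 1 - z * Complex.exp (Complex.I * θ) ≠ 0) (hn : n ≠ 0) :
    Complex.I * n * ((1 - z * Complex.exp (-(Complex.I * θ))) *
        (1 - z * Complex.exp (Complex.I * θ))) *
      (a / (n * (1 - z * Complex.exp (-(Complex.I * θ)))) -
        a / (n * (1 - z * Complex.exp (Complex.I * θ)))) =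
      2 * a * z * (Real.sin θ : ℂ) := by
  have hs : (Real.sin θ : ℂ) =
      (Complex.exp (-(Complex.I * θ)) - Complex.exp (Complex.I * θ)) * Complex.I / 2 := by
    rw [Complex.ofReal_sin, Complex.sin, neg_mul, mul_comm (θ : ℂ)]
  rw [hs]
  field_simp
  ring

/-- Normalizing a perturbed interpolation ratio by the unperturbed difference `d`, given through
`c * d = k`. -/
theorem half_mul_add_div_add_eq {K : Type*} [Field K] (h2 : (2 : K) ≠ 0) {c d k : K}
    (hk : k ≠ 0) (hcd : c * d = k) (s e f : K) :
    (1 / 2) * (s + e) / (d + f) =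
      ((1 / 2) * s / d + c * e / (2 * k)) / (1 + c * f / k) := by
  subst hcd
  have hc : c ≠ 0 := left_ne_zero_of_mul hk
  have hd : d ≠ 0 := right_ne_zero_of_mul hk
  rw [mul_div_mul_left _ _ hc, mul_left_comm 2 c d, mul_div_mul_left _ _ hc,
    show (1 / 2) * s / d + e / (2 * d) = (1 / 2) * (s + e) / d by field_simp,
    show 1 + f / d = (d + f) / d by field_simp, div_div_div_cancel_right₀ hd]

/-- Exact perturbation identity (Eq. (22)) for the A&M interpolation function
under additive perturbations `E_±` of the coefficients `X_±`. -/
theorem stmt_3 (N : ℕ) (hN : 1 ≤ N) (a z : ℂ) (ha : a ≠ 0) (hz : z ≠ 0)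
    (hsin : Real.sin (Real.pi / N) ≠ 0)
    (lam : ℂ)
    (hlam : lam = (1 - z * Complex.exp (-(Complex.I * Real.pi / N))) *
                  (1 - z * Complex.exp (Complex.I * Real.pi / N)))
    (hlam0 : lam ≠ 0)
    (Xp Xm h : ℂ)
    (hXp : Xp = a / (N * (1 - z * Complex.exp (-(Complex.I * Real.pi / N)))))
    (hXm : Xm = a / (N * (1 - z * Complex.exp (Complex.I * Real.pi / N))))
    (hh : h = (1 / 2) * (Xp + Xm) / (Xp - Xm))
    (Ep Em : ℂ) (hne : (Xp + Ep) - (Xm + Em) ≠ 0) :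
    (1 / 2) * ((Xp + Ep) + (Xm + Em)) / ((Xp + Ep) - (Xm + Em)) =
      (h + Complex.I * N * lam * (Ep + Em) /
          (4 * a * z * (Real.sin (Real.pi / N) : ℂ))) /
      (1 + Complex.I * N * lam * (Ep - Em) /
          (2 * a * z * (Real.sin (Real.pi / N) : ℂ))) := by
  have hN0 : (N : ℂ) ≠ 0 := Nat.cast_ne_zero.mpr (Nat.one_le_iff_ne_zero.mp hN)
  have hθ : Complex.I * Real.pi / N = Complex.I * ((Real.pi / N : ℝ) : ℂ) := by
    push_cast
    ring
  rw [hθ] at hlam hXp hXm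
  rw [hlam] at hlam0
  have hk : 2 * a * z * (Real.sin (Real.pi / N) : ℂ) ≠ 0 :=
    mul_ne_zero (mul_ne_zero (mul_ne_zero two_ne_zero ha) hz) (Complex.ofReal_ne_zero.mpr hsin)
  have hd : Complex.I * N * lam * (Xp - Xm) = 2 * a * z * (Real.sin (Real.pi / N) : ℂ) := by
    rw [hlam, hXp, hXm]
    exact div_one_sub_mul_exp_sub_div_one_sub_mul_exp N a z (Real.pi / N)
      (left_ne_zero_of_mul hlam0) (right_ne_zero_of_mul hlam0) hN0
  have key := half_mul_add_div_add_eq two_ne_zero hk hd (Xp + Xm) (Ep + Em) (Ep - Em)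
  rw [hh, add_add_add_comm Xp Ep, add_sub_add_comm Xp Ep, key,
    show 4 * a * z * (Real.sin (Real.pi / N) : ℂ) =
      2 * (2 * a * z * (Real.sin (Real.pi / N) : ℂ)) by ring]
end

section
/- Let N ≥ 2 be a natural number, A ∈ ℂ with A ≠ 0, and δ ∈ ℝ with 1 + exp(2πiδ) ≠ 0 and exp(2πi(δ − 1/2)/N) ≠ 1 and exp(2πi(δ + 1/2)/N) ≠ 1. Define X_± = (A/N)(1 + exp(2πiδ))/(1 − exp(2πi(δ ∓ 1/2)/N)) and h = (1/2)(X₊ + X₋)/(X₊ − X₋). Then X₊ ≠ X₋ and cos(π/N) − 2 i h·sin(π/N) = exp(−2πiδ/N). -/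
open Complex in
/-- For `X₊ = C / (1 - z (c - i s))` and `X₋ = C / (1 - z (c + i s))`, the quantity
`c - 2 i h s` with `h = (X₊ + X₋) / (2 (X₊ - X₋))` equals `z⁻¹`. -/
theorem div_ne_and_reconstruction_eq_inv {C z c s : ℂ} (hC : C ≠ 0) (hz : z ≠ 0) (hs : s ≠ 0)
    (hp : 1 - z * (c - s * I) ≠ 0) (hm : 1 - z * (c + s * I) ≠ 0) :
    C / (1 - z * (c - s * I)) ≠ C / (1 - z * (c + s * I)) ∧
      c - 2 * I * ((1 / 2) * (C / (1 - z * (c - s * I)) + C / (1 - z * (c + s * I))) /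
        (C / (1 - z * (c - s * I)) - C / (1 - z * (c + s * I)))) * s = z⁻¹ := by
  have hsub : C / (1 - z * (c - s * I)) - C / (1 - z * (c + s * I)) =
      -(2 * I * s * z * C) / ((1 - z * (c - s * I)) * (1 - z * (c + s * I))) := by
    rw [div_sub_div _ _ hp hm]
    ring
  have hadd : C / (1 - z * (c - s * I)) + C / (1 - z * (c + s * I)) =
      2 * C * (1 - c * z) / ((1 - z * (c - s * I)) * (1 - z * (c + s * I))) := by
    rw [div_add_div _ _ hp hm]
    ring
  refine ⟨fun h => ?_, ?_⟩
  · rw [← sub_eq_zero, hsub] at h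
    simp [hC, hz, hs, hp, hm] at h
  · have hI := I_ne_zero
    rw [hsub, hadd, ← mul_div_assoc (1 / 2 : ℂ), div_div_div_cancel_right₀ (mul_ne_zero hp hm)]
    field_simp
    ring

/-- In the noiseless single-tone case, the A&M reconstruction
`cos(π/N) − 2ih sin(π/N)` recovers `z⁻¹ = exp(−2πiδ/N)` exactly (Eqs. (4)–(6)). -/
theorem stmt_4 (N : ℕ) (hN : 2 ≤ N) (A : ℂ) (hA : A ≠ 0) (δ : ℝ)
    (h1 : 1 + Complex.exp (2 * Real.pi * Complex.I * δ) ≠ 0)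
    (h2 : Complex.exp (2 * Real.pi * Complex.I * ((δ - 1 / 2) / N)) ≠ 1)
    (h3 : Complex.exp (2 * Real.pi * Complex.I * ((δ + 1 / 2) / N)) ≠ 1)
    (Xp Xm h : ℂ)
    (hXp : Xp = (A / N) * (1 + Complex.exp (2 * Real.pi * Complex.I * δ)) /
        (1 - Complex.exp (2 * Real.pi * Complex.I * ((δ - 1 / 2) / N))))
    (hXm : Xm = (A / N) * (1 + Complex.exp (2 * Real.pi * Complex.I * δ)) /
        (1 - Complex.exp (2 * Real.pi * Complex.I * ((δ + 1 / 2) / N))))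
    (hh : h = (1 / 2) * (Xp + Xm) / (Xp - Xm)) :
    Xp ≠ Xm ∧
      (Real.cos (Real.pi / N) : ℂ) - 2 * Complex.I * h * (Real.sin (Real.pi / N) : ℂ) =
        Complex.exp (-(2 * Real.pi * Complex.I * δ / N)) := by
  have hN0 : (0 : ℝ) < N := by positivity
  have hNC : (N : ℂ) ≠ 0 := by exact_mod_cast hN0.ne'
  have hs : (Real.sin (Real.pi / N) : ℂ) ≠ 0 := by
    refine Complex.ofReal_ne_zero.mpr (Real.sin_pos_of_pos_of_lt_pi (by positivity) ?_).ne'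
    exact div_lt_self Real.pi_pos (by exact_mod_cast hN)
  have hep : Complex.exp (2 * Real.pi * Complex.I * ((δ - 1 / 2) / N)) =
      Complex.exp (2 * Real.pi * Complex.I * δ / N) *
        ((Real.cos (Real.pi / N) : ℂ) - (Real.sin (Real.pi / N) : ℂ) * Complex.I) := by
    rw [Complex.ofReal_cos, Complex.ofReal_sin, Complex.cos_sub_sin_I, ← Complex.exp_add]
    congr 1
    push_cast
    field_simp
    ring
  have hem : Complex.exp (2 * Real.pi * Complex.I * ((δ + 1 / 2) / N)) =
      Complex.exp (2 * Real.pi * Complex.I * δ / N) *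
        ((Real.cos (Real.pi / N) : ℂ) + (Real.sin (Real.pi / N) : ℂ) * Complex.I) := by
    rw [Complex.ofReal_cos, Complex.ofReal_sin, Complex.cos_add_sin_I, ← Complex.exp_add]
    congr 1
    push_cast
    field_simp
  rw [hep] at h2 hXp
  rw [hem] at h3 hXm
  rw [hh, hXp, hXm, Complex.exp_neg]
  exact div_ne_and_reconstruction_eq_inv (mul_ne_zero (div_ne_zero hA hNC) h1)
    (Complex.exp_ne_zero _) hs (sub_ne_zero.mpr h2.symm) (sub_ne_zero.mpr h3.symm)
end

section
/- Let N ≥ 2 be a natural number, A ∈ ℂ with A ≠ 0, m ∈ ℤ, and δ ∈ ℝ with −1/2 < δ < 1/2. Define X_± = (1/N)·∑_{n=0}^{N−1} A·exp(2πi(m+δ)n/N)·exp(−2πi(m ± 1/2)n/N), h = (1/2)(X₊ + X₋)/(X₊ − X₋), and δ̂ = −(N/(2π))·Im( Log( cos(π/N) − 2 i h·sin(π/N) ) ), where Log is the principal complex logarithm (imaginary part in (−π, π]). Then δ̂ = δ. -/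
open Finset

/-- A geometric sum of ratio `r` with `r ^ N = -b`, cleared of its denominator. -/
theorem mul_geom_sum_of_pow_eq_neg {K : Type*} [Field K] {r b : K} {N : ℕ} (hr : r ^ N = -b) :
    (1 - r) * ∑ n ∈ Finset.range N, r ^ n = 1 + b := by
  rw [mul_neg_geom_sum, hr, sub_neg_eq_add]

/-- The A&M interpolation function of half-bin Fourier coefficients, expressed through the phase
increment `w` of the signal and the half-bin phase `c`. -/
theorem interpolation_mul_eq {w c S Xp Xm : ℂ} (hw : w ≠ 0) (hS : S ≠ 0)
    (hcc : c - c⁻¹ ≠ 0) (hp : (1 - w * c⁻¹) * Xp = S) (hm : (1 - w * c) * Xm = S) :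
    (1 / 2) * (Xp + Xm) / (Xp - Xm) * (c - c⁻¹) = (c + c⁻¹) / 2 - w⁻¹ := by
  have hp0 : 1 - w * c⁻¹ ≠ 0 := left_ne_zero_of_mul (hp ▸ hS)
  have hm0 : 1 - w * c ≠ 0 := left_ne_zero_of_mul (hm ▸ hS)
  have hadd : (1 - w * c⁻¹) * (1 - w * c) * (Xp + Xm) = S * (2 - w * (c + c⁻¹)) := by
    linear_combination (1 - w * c) * hp + (1 - w * c⁻¹) * hm
  have hsub : (1 - w * c⁻¹) * (1 - w * c) * (Xp - Xm) = -(S * w * (c - c⁻¹)) := by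
    linear_combination (1 - w * c) * hp - (1 - w * c⁻¹) * hm
  have hD : Xp - Xm ≠ 0 :=
    right_ne_zero_of_mul (hsub ▸ neg_ne_zero.2 (mul_ne_zero (mul_ne_zero hS hw) hcc))
  rw [div_mul_eq_mul_div, div_eq_iff hD]
  apply mul_left_cancel₀ (mul_ne_zero hp0 hm0)
  have hww : w⁻¹ * w = 1 := inv_mul_cancel₀ hw
  linear_combination (1 / 2) * (c - c⁻¹) * hadd - ((c + c⁻¹) / 2 - w⁻¹) * hsub
    - S * (c - c⁻¹) * hww

/-- `exp (2πiδ) ≠ -1` when `δ` lies strictly between the half-bins. -/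
theorem one_add_exp_two_pi_mul_ne_zero {δ : ℝ} (h1 : -(1 / 2) < δ) (h2 : δ < 1 / 2) :
    1 + Complex.exp (2 * Real.pi * Complex.I * δ) ≠ 0 := by
  intro h
  have hre := congrArg Complex.re h
  rw [show (2 * Real.pi * Complex.I * δ : ℂ) = ((2 * (Real.pi * δ) : ℝ) : ℂ) * Complex.I by
    push_cast; ring] at hre
  simp only [Complex.add_re, Complex.one_re, Complex.exp_ofReal_mul_I_re, Complex.zero_re,
    Real.cos_two_mul] at hre
  have hpos : 0 < Real.cos (Real.pi * δ) :=
    Real.cos_pos_of_mem_Ioo ⟨by nlinarith [Real.pi_pos], by nlinarith [Real.pi_pos]⟩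
  nlinarith

/-- The A&M residual estimate is exact for a noiseless single complex
exponential with residual `δ ∈ (−1/2, 1/2)` (Eqs. (5)–(7)). -/
theorem stmt_5 (N : ℕ) (hN : 2 ≤ N) (A : ℂ) (hA : A ≠ 0) (m : ℤ) (δ : ℝ)
    (hδ1 : -(1 / 2) < δ) (hδ2 : δ < 1 / 2)
    (Xp Xm h : ℂ)
    (hXp : Xp = (1 / (N : ℂ)) * ∑ n ∈ Finset.range N,
        A * Complex.exp (2 * Real.pi * Complex.I * ((m + δ) * n / N)) *
          Complex.exp (-(2 * Real.pi * Complex.I * ((m + 1 / 2) * n / N))))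
    (hXm : Xm = (1 / (N : ℂ)) * ∑ n ∈ Finset.range N,
        A * Complex.exp (2 * Real.pi * Complex.I * ((m + δ) * n / N)) *
          Complex.exp (-(2 * Real.pi * Complex.I * ((m - 1 / 2) * n / N))))
    (hh : h = (1 / 2) * (Xp + Xm) / (Xp - Xm)) :
    -((N : ℝ) / (2 * Real.pi)) *
        (Complex.log ((Real.cos (Real.pi / N) : ℂ) -
          2 * Complex.I * h * (Real.sin (Real.pi / N) : ℂ))).im = δ := by
  have hN0 : (N : ℂ) ≠ 0 := Nat.cast_ne_zero.2 (by lia)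
  have hN2 : (2 : ℝ) ≤ N := by exact_mod_cast hN
  have hNpos : (0 : ℝ) < N := by linarith
  have hpi := Real.pi_pos
  set w : ℂ := Complex.exp (2 * Real.pi * Complex.I * (δ / N)) with hw
  set c : ℂ := Complex.exp (Real.pi / N * Complex.I) with hc
  have hwN : w ^ N = Complex.exp (2 * Real.pi * Complex.I * δ) := by
    rw [hw, ← Complex.exp_nat_mul]
    congr 1
    field_simp
  have hcN : c ^ N = -1 := by
    rw [hc, ← Complex.exp_nat_mul, ← Complex.exp_pi_mul_I]
    congr 1
    field_simp
  have hS : A / N * (1 + w ^ N) ≠ 0 :=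
    mul_ne_zero (div_ne_zero hA hN0) (hwN ▸ one_add_exp_two_pi_mul_ne_zero hδ1 hδ2)
  have hcinv : c⁻¹ = Complex.exp (-(Real.pi / N) * Complex.I) := by
    rw [hc, ← Complex.exp_neg, neg_mul]
  have hXp' : (1 - w * c⁻¹) * Xp = A / N * (1 + w ^ N) := by
    have hr : (w * c⁻¹) ^ N = -w ^ N := by
      rw [mul_pow, inv_pow, hcN]; norm_num
    rw [← mul_geom_sum_of_pow_eq_neg hr, hXp, mul_sum, mul_sum, mul_sum, mul_sum]
    refine sum_congr rfl fun n _ => ?_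
    rw [hcinv, hw, ← Complex.exp_add, ← Complex.exp_nat_mul, mul_assoc A, ← Complex.exp_add]
    rw [show 2 * Real.pi * Complex.I * ((m + δ) * n / N) +
      -(2 * Real.pi * Complex.I * ((m + 1 / 2) * n / N)) =
      (n : ℂ) * (2 * Real.pi * Complex.I * (δ / N) + -(Real.pi / N) * Complex.I) by ring]
    ring
  have hXm' : (1 - w * c) * Xm = A / N * (1 + w ^ N) := by
    have hr : (w * c) ^ N = -w ^ N := by
      rw [mul_pow, hcN, mul_neg_one]
    rw [← mul_geom_sum_of_pow_eq_neg hr, hXm, mul_sum, mul_sum, mul_sum, mul_sum]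
    refine sum_congr rfl fun n _ => ?_
    rw [hc, hw, ← Complex.exp_add, ← Complex.exp_nat_mul, mul_assoc A, ← Complex.exp_add]
    rw [show 2 * Real.pi * Complex.I * ((m + δ) * n / N) +
      -(2 * Real.pi * Complex.I * ((m - 1 / 2) * n / N)) =
      (n : ℂ) * (2 * Real.pi * Complex.I * (δ / N) + Real.pi / N * Complex.I) by ring]
    ring
  have hcos : (Real.cos (Real.pi / N) : ℂ) = (c + c⁻¹) / 2 := by
    rw [hcinv, hc]
    push_cast
    rfl
  have hsin : 2 * Complex.I * (Real.sin (Real.pi / N) : ℂ) = c - c⁻¹ := by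
    rw [hcinv, hc]
    push_cast
    rw [Complex.sin]
    linear_combination (Complex.exp (-(Real.pi / N) * Complex.I) -
      Complex.exp (Real.pi / N * Complex.I)) * Complex.I_sq
  have hsin0 : Real.sin (Real.pi / N) ≠ 0 :=
    (Real.sin_pos_of_pos_of_lt_pi (by positivity) (div_lt_self hpi (by linarith))).ne'
  have hcc : c - c⁻¹ ≠ 0 := hsin ▸ mul_ne_zero (mul_ne_zero two_ne_zero Complex.I_ne_zero)
    (Complex.ofReal_ne_zero.2 hsin0)
  have hlog : (Real.cos (Real.pi / N) : ℂ) - 2 * Complex.I * h * (Real.sin (Real.pi / N) : ℂ) =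
      Complex.exp ((-(2 * Real.pi * (δ / N)) : ℝ) * Complex.I) := by
    have hint := interpolation_mul_eq (Complex.exp_ne_zero _) hS hcc hXp' hXm'
    rw [← hh] at hint
    trans w⁻¹
    · linear_combination hcos - h * hsin - hint
    · rw [hw, ← Complex.exp_neg]
      congr 1
      push_cast
      ring
  have hbound : |δ / N| < 1 / 2 := by
    rw [abs_div, abs_of_pos hNpos, div_lt_iff₀ hNpos]
    have := abs_lt.2 ⟨hδ1, hδ2⟩
    linarith
  obtain ⟨hlo, hhi⟩ := abs_lt.1 hbound
  rw [hlog, Complex.log_exp (by simp; nlinarith) (by simp; nlinarith), Complex.im_ofReal_mul,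
    Complex.I_im]
  field_simp
end

section
/- Let N ≥ 1 be a natural number and L ≥ 1. For l = 1,…,L let A_l ∈ ℂ, m_l ∈ ℤ, δ_l ∈ ℝ, and let the noiseless signal be x(n) = ∑_{l=1}^{L} A_l·exp(2πi(m_l+δ_l)n/N) for n = 0,…,N−1. Fix p ∈ {1,…,L}, ν_p ∈ ℝ, and s ∈ {+1,−1}. Assume exp(2πi(δ_p − ν_p − s/2)/N) ≠ 1 and, for every l ≠ p, exp(2πi(m_l − m_p + δ_l − ν_p − s/2)/N) ≠ 1. Then (1/N)·∑_{n=0}^{N−1} x(n)·exp(−2πi(m_p + ν_p + s/2)n/N) − ∑_{l≠p} (A_l/N)·(1 + exp(2πi(δ_l − ν_p)))/(1 − exp(2πi(m_l − m_p + δ_l − ν_p − s/2)/N)) = (A_p/N)·(1 + exp(2πi(δ_p − ν_p)))/(1 − exp(2πi(δ_p − ν_p − s/2)/N)). -/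
open Finset

/-- The half-bin geometric sum: at an integer-plus-half offset from `a`, the Dirichlet sum has
numerator `1 + exp (2πia)`. -/
theorem sum_exp_half_bin (N : ℕ) (hN : N ≠ 0) (k : ℤ) (a : ℂ) (s : ℝ) (hs : s = 1 ∨ s = -1)
    (h : Complex.exp (2 * Real.pi * Complex.I * ((k + a - s / 2) / N)) ≠ 1) :
    ∑ n ∈ Finset.range N, Complex.exp (2 * Real.pi * Complex.I * ((k + a - s / 2) / N)) ^ n =
      (1 + Complex.exp (2 * Real.pi * Complex.I * a)) /
        (1 - Complex.exp (2 * Real.pi * Complex.I * ((k + a - s / 2) / N))) := by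
  have hN' : (N : ℂ) ≠ 0 := Nat.cast_ne_zero.mpr hN
  have hpow : Complex.exp (2 * Real.pi * Complex.I * ((k + a - s / 2) / N)) ^ N =
      -Complex.exp (2 * Real.pi * Complex.I * a) := by
    rw [← Complex.exp_nat_mul]
    have hexp : (N : ℂ) * (2 * Real.pi * Complex.I * ((k + a - s / 2) / N)) =
        2 * Real.pi * Complex.I * a + -(s * (Real.pi * Complex.I)) +
          k * (2 * Real.pi * Complex.I) := by
      field_simp
      ring
    rw [hexp, Complex.exp_add, Complex.exp_int_mul_two_pi_mul_I, mul_one, Complex.exp_add]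
    rcases hs with rfl | rfl <;> simp [Complex.exp_neg, Complex.exp_pi_mul_I]
  rw [geom_sum_eq h, hpow, ← neg_div_neg_eq]
  congr 1 <;> ring

/-- Exact leakage cancellation (Eqs. (12)–(13)): subtracting the true leakage of
the other components from the Fourier coefficient of the multi-tone signal at a
half-bin location leaves exactly the single-tone coefficient of component `p`. -/
theorem stmt_6 (N : ℕ) (hN : 1 ≤ N) (L : ℕ) (hL : 1 ≤ L)
    (A : Fin L → ℂ) (m : Fin L → ℤ) (δ : Fin L → ℝ)
    (p : Fin L) (ν : ℝ) (s : ℝ) (hs : s = 1 ∨ s = -1)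
    (hp : Complex.exp (2 * Real.pi * Complex.I * ((δ p - ν - s / 2) / N)) ≠ 1)
    (hl : ∀ l : Fin L, l ≠ p →
      Complex.exp (2 * Real.pi * Complex.I * ((m l - m p + δ l - ν - s / 2) / N)) ≠ 1) :
    (1 / (N : ℂ)) * ∑ n ∈ Finset.range N,
        (∑ l : Fin L,
            A l * Complex.exp (2 * Real.pi * Complex.I * ((m l + δ l) * n / N))) *
          Complex.exp (-(2 * Real.pi * Complex.I * ((m p + ν + s / 2) * n / N))) -
      ∑ l ∈ Finset.univ.erase p,
        (A l / N) * (1 + Complex.exp (2 * Real.pi * Complex.I * (δ l - ν))) /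
          (1 - Complex.exp (2 * Real.pi * Complex.I * ((m l - m p + δ l - ν - s / 2) / N))) =
    (A p / N) * (1 + Complex.exp (2 * Real.pi * Complex.I * (δ p - ν))) /
      (1 - Complex.exp (2 * Real.pi * Complex.I * ((δ p - ν - s / 2) / N))) := by
  have hN0 : N ≠ 0 := by omega
  have tone : ∀ l : Fin L,
      Complex.exp (2 * Real.pi * Complex.I * ((m l - m p + δ l - ν - s / 2) / N)) ≠ 1 →
      (1 / (N : ℂ)) * ∑ n ∈ Finset.range N,
        A l * Complex.exp (2 * Real.pi * Complex.I * ((m l + δ l) * n / N)) *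
          Complex.exp (-(2 * Real.pi * Complex.I * ((m p + ν + s / 2) * n / N))) =
      (A l / N) * (1 + Complex.exp (2 * Real.pi * Complex.I * (δ l - ν))) /
        (1 - Complex.exp (2 * Real.pi * Complex.I * ((m l - m p + δ l - ν - s / 2) / N))) := by
    intro l h
    have harg : ((m l - m p + δ l - ν - s / 2 : ℂ)) =
        ((m l - m p : ℤ) : ℂ) + (δ l - ν) - s / 2 := by
      push_cast
      ring
    rw [harg] at h ⊢
    rw [mul_div_assoc, ← sum_exp_half_bin N hN0 _ _ s hs h, Finset.mul_sum, Finset.mul_sum]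
    refine Finset.sum_congr rfl fun n _ => ?_
    rw [mul_assoc (A l), ← Complex.exp_add, ← Complex.exp_nat_mul, ← mul_assoc,
      one_div_mul_eq_div]
    congr 2
    push_cast
    ring
  have hpp : ((m p - m p + δ p - ν - s / 2 : ℂ)) = δ p - ν - s / 2 := by ring
  have hself := tone p (by rwa [hpp])
  rw [hpp] at hself
  simp_rw [Finset.sum_mul]
  rw [Finset.sum_comm, Finset.mul_sum, ← Finset.add_sum_erase _ _ (Finset.mem_univ p), hself,
    Finset.sum_congr rfl fun l hmem => tone l (hl l (Finset.ne_of_mem_erase hmem))]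
  exact add_sub_cancel_right _ _
end

section
/- Let N ≥ 2 be a natural number and L ≥ 1, and let the noiseless signal be x(n) = ∑_{l=1}^{L} A_l·exp(2πi(m_l+δ_l)n/N) with A_l ∈ ℂ, m_l ∈ ℤ, δ_l ∈ ℝ. Fix p with A_p ≠ 0 and let ν_p ∈ ℝ satisfy −1/2 < δ_p − ν_p < 1/2. Assume that for every l ≠ p and each sign s ∈ {+1,−1}, exp(2πi(m_l − m_p + δ_l − ν_p − s/2)/N) ≠ 1. Define, for s ∈ {+1,−1}, Ŝ_s = (1/N)·∑_{n=0}^{N−1} x(n)·exp(−2πi(m_p + ν_p + s/2)n/N) − ∑_{l≠p} (A_l/N)·(1 + exp(2πi(δ_l − ν_p)))/(1 − exp(2πi(m_l − m_p + δ_l − ν_p − s/2)/N)), let ĥ = (1/2)(Ŝ₊ + Ŝ₋)/(Ŝ₊ − Ŝ₋), and let δ̂ = ν_p − (N/(2π))·Im( Log( cos(π/N) − 2 i ĥ·sin(π/N) ) ), where Log is the principal complex logarithm. Then δ̂ = δ_p. -/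
open Finset

/-- The exponential geometric sum as a ratio: the `N`-point Fourier coefficient of a single tone. -/
theorem sum_range_exp_two_pi_mul_div (N : ℕ) (hN : N ≠ 0) (x : ℂ)
    (hx : Complex.exp (2 * Real.pi * Complex.I * (x / N)) ≠ 1) :
    ∑ n ∈ Finset.range N, Complex.exp (2 * Real.pi * Complex.I * (x * n / N)) =
      (1 - Complex.exp (2 * Real.pi * Complex.I * x)) /
        (1 - Complex.exp (2 * Real.pi * Complex.I * (x / N))) := by
  have hN' : (N : ℂ) ≠ 0 := Nat.cast_ne_zero.mpr hN
  have hterm (n : ℕ) : Complex.exp (2 * Real.pi * Complex.I * (x * n / N)) =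
      Complex.exp (2 * Real.pi * Complex.I * (x / N)) ^ n := by
    rw [← Complex.exp_nat_mul]
    congr 1
    ring
  have hpow : Complex.exp (2 * Real.pi * Complex.I * (x / N)) ^ N =
      Complex.exp (2 * Real.pi * Complex.I * x) := by
    rw [← Complex.exp_nat_mul]
    congr 1
    field_simp
  simp_rw [hterm]
  rw [geom_sum_eq hx, hpow, ← neg_sub, ← neg_sub 1 (Complex.exp (_ * (x / N))), neg_div_neg_eq]

/-- At an offset `t` with `exp (-2πit) = -1`, subtracting the exact leakage of the other tones from
the Fourier coefficient leaves the contribution of the tone `p`. -/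
theorem fourier_coeff_sub_leakage {ι : Type*} [Fintype ι] [DecidableEq ι] (N : ℕ) (hN : N ≠ 0)
    (A : ι → ℂ) (m : ι → ℤ) (δ : ι → ℝ) (p : ι) (ν : ℝ) (t : ℂ)
    (ht : Complex.exp (-(2 * Real.pi * Complex.I * t)) = -1)
    (hsep : ∀ l, Complex.exp (2 * Real.pi * Complex.I * ((m l - m p + δ l - ν - t) / N)) ≠ 1) :
    (1 / (N : ℂ)) * ∑ n ∈ Finset.range N,
        (∑ l, A l * Complex.exp (2 * Real.pi * Complex.I * ((m l + δ l) * n / N))) *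
          Complex.exp (-(2 * Real.pi * Complex.I * ((m p + ν + t) * n / N))) -
      ∑ l ∈ Finset.univ.erase p,
        (A l / N) * (1 + Complex.exp (2 * Real.pi * Complex.I * (δ l - ν))) /
          (1 - Complex.exp (2 * Real.pi * Complex.I * ((m l - m p + δ l - ν - t) / N))) =
    (A p / N) * (1 + Complex.exp (2 * Real.pi * Complex.I * (δ p - ν))) /
      (1 - Complex.exp (2 * Real.pi * Complex.I * ((δ p - ν - t) / N))) := by
  have hphase (l : ι) : Complex.exp (2 * Real.pi * Complex.I * (m l - m p + δ l - ν - t)) =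
      -Complex.exp (2 * Real.pi * Complex.I * (δ l - ν)) := by
    have hsplit : 2 * Real.pi * Complex.I * (m l - m p + δ l - ν - t) =
        2 * Real.pi * Complex.I * (δ l - ν) + -(2 * Real.pi * Complex.I * t) +
          ((m l - m p : ℤ) : ℂ) * (2 * Real.pi * Complex.I) := by
      push_cast
      ring
    rw [hsplit, Complex.exp_add, Complex.exp_int_mul_two_pi_mul_I, Complex.exp_add, ht]
    ring
  have hcoeff : (1 / (N : ℂ)) * ∑ n ∈ Finset.range N,
        (∑ l, A l * Complex.exp (2 * Real.pi * Complex.I * ((m l + δ l) * n / N))) *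
          Complex.exp (-(2 * Real.pi * Complex.I * ((m p + ν + t) * n / N))) =
      ∑ l, (A l / N) * (1 + Complex.exp (2 * Real.pi * Complex.I * (δ l - ν))) /
          (1 - Complex.exp (2 * Real.pi * Complex.I * ((m l - m p + δ l - ν - t) / N))) := by
    simp_rw [Finset.sum_mul]
    rw [Finset.sum_comm, Finset.mul_sum]
    refine Finset.sum_congr rfl fun l _ => ?_
    have hterm (n : ℕ) :
        A l * Complex.exp (2 * Real.pi * Complex.I * ((m l + δ l) * n / N)) *
          Complex.exp (-(2 * Real.pi * Complex.I * ((m p + ν + t) * n / N))) =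
        A l * Complex.exp
          (2 * Real.pi * Complex.I * ((m l - m p + δ l - ν - t) * n / N)) := by
      rw [mul_assoc, ← Complex.exp_add]
      congr 2
      ring
    simp_rw [hterm]
    rw [← Finset.mul_sum, sum_range_exp_two_pi_mul_div N hN _ (hsep l), hphase]
    ring
  rw [hcoeff, ← Finset.add_sum_erase _ _ (Finset.mem_univ p), add_sub_cancel_right, sub_self,
    zero_add]

/-- `exp (2πiy) ≠ 1` for a nonzero real `y` with `|y| < 1`. -/
theorem exp_two_pi_I_mul_ne_one {y : ℝ} (hy : y ≠ 0) (hy1 : |y| < 1) :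
    Complex.exp (2 * Real.pi * Complex.I * y) ≠ 1 := by
  intro h
  obtain ⟨k, hk⟩ := Complex.exp_eq_one_iff.mp h
  rw [mul_comm] at hk
  have hyk : y = k := by exact_mod_cast mul_right_cancel₀ Complex.two_pi_I_ne_zero hk
  subst hyk
  have : |k| < 1 := by exact_mod_cast hy1
  exact hy (by exact_mod_cast Int.abs_lt_one_iff.mp this)

/-- The half-bin interpolation of two coefficients `C / (1 - u q⁻¹)` and `C / (1 - u q)`,
where `q = exp (iθ)`, recovers `u⁻¹`. -/
theorem cos_sub_interpolation_mul_sin {C u θ : ℂ} (hC : C ≠ 0) (hu : u ≠ 0)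
    (hθ : Complex.sin θ ≠ 0)
    (hp : 1 - u * Complex.exp (-(θ * Complex.I)) ≠ 0)
    (hm : 1 - u * Complex.exp (θ * Complex.I) ≠ 0) :
    Complex.cos θ - 2 * Complex.I *
      ((1 / 2) * (C / (1 - u * Complex.exp (-(θ * Complex.I))) +
          C / (1 - u * Complex.exp (θ * Complex.I))) /
        (C / (1 - u * Complex.exp (-(θ * Complex.I))) -
          C / (1 - u * Complex.exp (θ * Complex.I)))) * Complex.sin θ = u⁻¹ := by
  rw [← neg_mul, Complex.exp_mul_I, Complex.exp_mul_I, Complex.cos_neg, Complex.sin_neg] at *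
  generalize Complex.cos θ = c at *
  generalize Complex.sin θ = s at *
  have hsum : C / (1 - u * (c + -s * Complex.I)) + C / (1 - u * (c + s * Complex.I)) =
      C * (2 - 2 * u * c) /
        ((1 - u * (c + -s * Complex.I)) * (1 - u * (c + s * Complex.I))) := by
    rw [div_add_div _ _ hp hm]
    ring
  have hdiff : C / (1 - u * (c + -s * Complex.I)) - C / (1 - u * (c + s * Complex.I)) =
      C * (-2 * Complex.I * u * s) /
        ((1 - u * (c + -s * Complex.I)) * (1 - u * (c + s * Complex.I))) := by
    rw [div_sub_div _ _ hp hm]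
    ring
  have hI := Complex.I_ne_zero
  rw [hsum, hdiff, mul_div_assoc, div_div_div_cancel_right₀ (mul_ne_zero hp hm)]
  field_simp
  ring

/-- Exact noiseless fixed-point property (Theorem 2, Table I): one iteration of
the proposed multi-component estimator for component `p`, using the true
amplitudes and residuals of the other components, returns the true residual `δ_p`. -/
theorem stmt_7 (N : ℕ) (hN : 2 ≤ N) (L : ℕ) (hL : 1 ≤ L)
    (A : Fin L → ℂ) (m : Fin L → ℤ) (δ : Fin L → ℝ)
    (p : Fin L) (hA : A p ≠ 0) (ν : ℝ)
    (hν1 : -(1 / 2) < δ p - ν) (hν2 : δ p - ν < 1 / 2)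
    (hsep : ∀ l : Fin L, l ≠ p → ∀ s : ℝ, s = 1 ∨ s = -1 →
      Complex.exp (2 * Real.pi * Complex.I * ((m l - m p + δ l - ν - s / 2) / N)) ≠ 1)
    (Sp Sm hhat : ℂ)
    (hSp : Sp = (1 / (N : ℂ)) * ∑ n ∈ Finset.range N,
        (∑ l : Fin L,
            A l * Complex.exp (2 * Real.pi * Complex.I * ((m l + δ l) * n / N))) *
          Complex.exp (-(2 * Real.pi * Complex.I * ((m p + ν + 1 / 2) * n / N))) -
      ∑ l ∈ Finset.univ.erase p,
        (A l / N) * (1 + Complex.exp (2 * Real.pi * Complex.I * (δ l - ν))) /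
          (1 - Complex.exp (2 * Real.pi * Complex.I * ((m l - m p + δ l - ν - 1 / 2) / N))))
    (hSm : Sm = (1 / (N : ℂ)) * ∑ n ∈ Finset.range N,
        (∑ l : Fin L,
            A l * Complex.exp (2 * Real.pi * Complex.I * ((m l + δ l) * n / N))) *
          Complex.exp (-(2 * Real.pi * Complex.I * ((m p + ν - 1 / 2) * n / N))) -
      ∑ l ∈ Finset.univ.erase p,
        (A l / N) * (1 + Complex.exp (2 * Real.pi * Complex.I * (δ l - ν))) /
          (1 - Complex.exp (2 * Real.pi * Complex.I * ((m l - m p + δ l - ν + 1 / 2) / N))))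
    (hhhat : hhat = (1 / 2) * (Sp + Sm) / (Sp - Sm)) :
    ν - (N : ℝ) / (2 * Real.pi) *
        (Complex.log ((Real.cos (Real.pi / N) : ℂ) -
          2 * Complex.I * hhat * (Real.sin (Real.pi / N) : ℂ))).im = δ p := by
  have hN0 : N ≠ 0 := by omega
  have hNpos : (0 : ℝ) < N := by positivity
  have hN2 : (2 : ℝ) ≤ N := by exact_mod_cast hN
  have hNC : (N : ℂ) ≠ 0 := Nat.cast_ne_zero.mpr hN0
  have hne (t : ℝ) (ht0 : δ p - ν - t ≠ 0) (ht : |δ p - ν - t| < 1) :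
      Complex.exp (2 * Real.pi * Complex.I * ((δ p - ν - t) / N)) ≠ 1 := by
    have h := exp_two_pi_I_mul_ne_one (y := (δ p - ν - t) / N) (div_ne_zero ht0 hNpos.ne')
      (by
        rw [abs_div, abs_of_pos hNpos, div_lt_one hNpos]
        linarith)
    push_cast at h
    exact h
  have hnep := hne (1 / 2) (by linarith) (by rw [abs_lt]; constructor <;> linarith)
  have hnem := hne (-(1 / 2)) (by linarith) (by rw [abs_lt]; constructor <;> linarith)
  push_cast at hnep hnem
  have hsepp (l : Fin L) : Complex.exp
      (2 * Real.pi * Complex.I * ((m l - m p + δ l - ν - 1 / 2) / N)) ≠ 1 := by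
    by_cases hl : l = p
    · subst hl
      simpa using hnep
    · simpa using hsep l hl 1 (Or.inl rfl)
  have hsepm (l : Fin L) : Complex.exp
      (2 * Real.pi * Complex.I * ((m l - m p + δ l - ν - -(1 / 2)) / N)) ≠ 1 := by
    by_cases hl : l = p
    · subst hl
      simpa using hnem
    · simpa [neg_div] using hsep l hl (-1) (Or.inr rfl)
  have htp : Complex.exp (-(2 * Real.pi * Complex.I * (1 / 2))) = -1 := by
    rw [show 2 * (Real.pi : ℂ) * Complex.I * (1 / 2) = Real.pi * Complex.I by ring,
      Complex.exp_neg, Complex.exp_pi_mul_I]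
    norm_num
  have htm : Complex.exp (-(2 * Real.pi * Complex.I * -(1 / 2))) = -1 := by
    rw [show -(2 * (Real.pi : ℂ) * Complex.I * -(1 / 2)) = Real.pi * Complex.I by ring,
      Complex.exp_pi_mul_I]
  have hp := fourier_coeff_sub_leakage N hN0 A m δ p ν (1 / 2) htp hsepp
  have hm := fourier_coeff_sub_leakage N hN0 A m δ p ν (-(1 / 2)) htm hsepm
  rw [hp] at hSp
  simp only [← sub_eq_add_neg, sub_neg_eq_add] at hm hnem
  rw [hm] at hSm
  set u := Complex.exp (2 * Real.pi * Complex.I * ((δ p - ν) / N)) with hu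
  have hup : Complex.exp (2 * Real.pi * Complex.I * ((δ p - ν - 1 / 2) / N)) =
      u * Complex.exp (-((Real.pi / N : ℝ) * Complex.I)) := by
    rw [hu, ← Complex.exp_add]
    congr 1
    push_cast
    ring
  have hum : Complex.exp (2 * Real.pi * Complex.I * ((δ p - ν + 1 / 2) / N)) =
      u * Complex.exp ((Real.pi / N : ℝ) * Complex.I) := by
    rw [hu, ← Complex.exp_add]
    congr 1
    push_cast
    ring
  rw [hup] at hSp hnep
  rw [hum] at hSm hnem
  have hC : A p / N * (1 + Complex.exp (2 * Real.pi * Complex.I * (δ p - ν))) ≠ 0 := by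
    refine mul_ne_zero (div_ne_zero hA hNC) fun h => ?_
    refine exp_two_pi_I_mul_ne_one (y := δ p - ν - 1 / 2) (by linarith)
      (by rw [abs_lt]; constructor <;> linarith) ?_
    have hsplit : 2 * Real.pi * Complex.I * (δ p - ν - 1 / 2 : ℝ) =
        2 * Real.pi * Complex.I * (δ p - ν) + -(2 * Real.pi * Complex.I * (1 / 2)) := by
      push_cast
      ring
    rw [hsplit, Complex.exp_add, htp]
    linear_combination -h
  have hsin : Complex.sin (Real.pi / N : ℝ) ≠ 0 := by
    rw [← Complex.ofReal_sin, Complex.ofReal_ne_zero]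
    refine (Real.sin_pos_of_pos_of_lt_pi (by positivity) ?_).ne'
    exact div_lt_self Real.pi_pos (by linarith)
  have hz := cos_sub_interpolation_mul_sin (u := u) hC (Complex.exp_ne_zero _) hsin
    (sub_ne_zero.mpr hnep.symm) (sub_ne_zero.mpr hnem.symm)
  rw [hhhat, hSp, hSm, Complex.ofReal_cos, Complex.ofReal_sin, hz, hu, ← Complex.exp_neg]
  have harg : -(2 * Real.pi * Complex.I * ((δ p - ν) / N)) =
      ((-(2 * Real.pi * (δ p - ν) / N) : ℝ) : ℂ) * Complex.I := by
    push_cast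
    ring
  have hlow : -Real.pi < -(2 * Real.pi * (δ p - ν) / N) := by
    rw [neg_lt_neg_iff, div_lt_iff₀ hNpos]
    nlinarith [Real.pi_pos]
  have hhigh : -(2 * Real.pi * (δ p - ν) / N) ≤ Real.pi := by
    rw [neg_le, le_div_iff₀ hNpos]
    nlinarith [Real.pi_pos]
  rw [harg, Complex.log_exp (by simpa using hlow) (by simpa using hhigh), Complex.im_ofReal_mul,
    Complex.I_im]
  field_simp
  ring
end

section
/- Fix δ' ∈ ℝ. Then, as the natural number N tends to infinity, (1 − exp(2πiδ'/N)·cos(π/N)) / (−2 i·exp(2πiδ'/N)·sin(π/N)) converges to δ' (as a complex number). -/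
open Filter

/-- One-point l'Hôpital rule over a normed field: if `f` and `g` vanish at `a`, then `f / g` tends to
the quotient of their derivatives at `a`. -/
theorem HasDerivAt.tendsto_div_of_eq_zero {𝕜 : Type*} [NontriviallyNormedField 𝕜] {f g : 𝕜 → 𝕜}
    {f' g' a : 𝕜} (hf : HasDerivAt f f' a) (hg : HasDerivAt g g' a) (hfa : f a = 0)
    (hga : g a = 0) (hg' : g' ≠ 0) :
    Tendsto (fun x => f x / g x) (nhdsWithin a {a}ᶜ) (nhds (f' / g')) := by
  refine (hf.tendsto_slope.div hg.tendsto_slope hg').congr' ?_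
  filter_upwards [self_mem_nhdsWithin] with x hx
  have hx : x - a ≠ 0 := sub_ne_zero.mpr hx
  simp only [Pi.div_apply, slope_def_field, hfa, hga, sub_zero]
  exact div_div_div_cancel_right₀ hx _ _

/-- Leading-order behaviour of the noiseless A&M interpolation function
(Eq. (55)): `h₁ = (1 − z cos(π/N))/(−2iz sin(π/N)) → δ'` as `N → ∞`,
where `z = exp(2πiδ'/N)`. -/
theorem stmt_9 (δ' : ℝ) :
    Tendsto (fun N : ℕ =>
        (1 - Complex.exp (2 * Real.pi * Complex.I * δ' / N) *
            (Real.cos (Real.pi / N) : ℂ)) /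
          (-(2 * Complex.I * Complex.exp (2 * Real.pi * Complex.I * δ' / N) *
            (Real.sin (Real.pi / N) : ℂ))))
      atTop (nhds (δ' : ℂ)) := by
  have hπ : (Real.pi : ℂ) ≠ 0 := Complex.ofReal_ne_zero.mpr Real.pi_ne_zero
  have hexp : HasDerivAt (fun t : ℂ => Complex.exp (2 * Real.pi * Complex.I * δ' * t))
      (2 * Real.pi * Complex.I * δ') 0 := by
    simpa using ((hasDerivAt_id (0 : ℂ)).const_mul (2 * Real.pi * Complex.I * δ')).cexp
  have hcos : HasDerivAt (fun t : ℂ => Complex.cos (Real.pi * t)) 0 0 := by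
    simpa using ((hasDerivAt_id (0 : ℂ)).const_mul (Real.pi : ℂ)).ccos
  have hsin : HasDerivAt (fun t : ℂ => Complex.sin (Real.pi * t)) Real.pi 0 := by
    simpa using ((hasDerivAt_id (0 : ℂ)).const_mul (Real.pi : ℂ)).csin
  have hnum : HasDerivAt (fun t : ℂ => 1 - Complex.exp (2 * Real.pi * Complex.I * δ' * t) *
      Complex.cos (Real.pi * t)) (-(2 * Real.pi * Complex.I * δ')) 0 := by
    simpa using (hexp.fun_mul hcos).const_sub 1
  have hden : HasDerivAt (fun t : ℂ => -(2 * Complex.I *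
      Complex.exp (2 * Real.pi * Complex.I * δ' * t) * Complex.sin (Real.pi * t)))
      (-(2 * Complex.I * Real.pi)) 0 := by
    simpa using ((hexp.const_mul (2 * Complex.I)).fun_mul hsin).fun_neg
  have hlim := hnum.tendsto_div_of_eq_zero hden (by simp) (by simp) (by simp [hπ])
  have hval : -(2 * Real.pi * Complex.I * δ') / -(2 * Complex.I * Real.pi) = (δ' : ℂ) := by
    have := Complex.I_ne_zero
    field_simp
  rw [hval] at hlim
  have hinv : Tendsto (fun N : ℕ => (N : ℂ)⁻¹) atTop (nhdsWithin 0 {0}ᶜ) := by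
    refine tendsto_nhdsWithin_iff.mpr ⟨tendsto_inv_atTop_nhds_zero_nat, ?_⟩
    filter_upwards [eventually_ne_atTop 0] with N hN
    simpa using hN
  simpa [Function.comp_def, div_eq_mul_inv] using hlim.comp hinv
end
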